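/- Let (Y, 𝒟, ν, G) be an MDS, let 𝐃 = {d_F : F ∈ 𝓕_G} ⊆ L¹(Y, 𝒟, ν) be a non-negative sup-additive G-invariant family, and let {F_n : n ∈ ℕ} be a Følner sequence of G satisfying the Tempelman condition with constant M > 0. If either every F_n tiles G, or the family 𝐃 is strongly sup-additive, then for every α > 0, ν({y ∈ Y : sup_{k ∈ ℕ} d_{F_k}(y)/|F_k| > α}) ≤ (M/α) · ν(𝐃). -/

import Mathlib

open MeasureTheory Filter Topology
open scoped symmDiff Pointwise ENNReal

/-- `F` is a Følner sequence of `G`. -/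
def IsFolner {G : Type*} [Group G] [DecidableEq G] (F : ℕ → Finset G) : Prop :=
  (∀ n, (F n).Nonempty) ∧
    ∀ g : G, Tendsto (fun n => ((((F n).image (g * ·)) ∆ (F n)).card : ℝ) / ((F n).card : ℝ))
      atTop (𝓝 0)

/-- `F` satisfies the Tempelman condition with constant `M`. -/
def TempelmanWith {G : Type*} [Group G] [DecidableEq G] (F : ℕ → Finset G) (M : ℝ) : Prop :=
  ∀ n : ℕ, ((((Finset.range (n + 1)).biUnion fun k => (F k)⁻¹ * F n).card : ℝ))
      ≤ M * ((F n).card : ℝ)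

/-- A non-empty finite subset `T` tiles `G` if some family of right translates
`{T c : c ∈ C}` forms a partition of `G`. -/
def Tiles {G : Type*} [Group G] (T : Finset G) : Prop :=
  T.Nonempty ∧ ∃ C : Set G, ∀ x : G, ∃! c : G, c ∈ C ∧ ∃ t ∈ T, x = t * c

/-- Vitali-type covering: finitely many translates `F (k g) * g` contain a disjoint subfamily whose
total size controls the number of centres. -/
lemma TempelmanWith.exists_disjoint_translates {G : Type*} [Group G] [DecidableEq G]
    {F : ℕ → Finset G} {M : ℝ} (hT : TempelmanWith F M) (hne : ∀ n, (F n).Nonempty)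
    (k : G → ℕ) (B : Finset G) :
    ∃ C ⊆ B, (C : Set G).PairwiseDisjoint (fun c => (F (k c)).image (· * c)) ∧
      (B.card : ℝ) ≤ M * ∑ c ∈ C, ((F (k c)).card : ℝ) := by
  induction B using Finset.strongInduction with
  | H B ih =>
    rcases B.eq_empty_or_nonempty with rfl | hB
    · exact ⟨∅, by simp, by simp, by simp⟩
    obtain ⟨c, hc, hmax⟩ := B.exists_max_image k hB
    let P : G → Finset G := fun g => (F (k g)).image (· * g)
    have hcc : ¬ Disjoint (P c) (P c) := fun h =>
      ((hne (k c)).image (· * c)).ne_empty (Finset.disjoint_self_iff_empty _ |>.1 h)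
    obtain ⟨C, hCB, hdisj, hcard⟩ := ih (B.filter fun g => Disjoint (P g) (P c))
      (Finset.filter_ssubset.2 ⟨c, hc, hcc⟩)
    have hcC : c ∉ C := fun h => hcc (Finset.mem_filter.1 (hCB h)).2
    refine ⟨insert c C, ?_, ?_, ?_⟩
    · exact Finset.insert_subset hc (hCB.trans (Finset.filter_subset _ _))
    · rw [Finset.coe_insert]
      exact hdisj.insert fun g hg _ => (Finset.mem_filter.1 (hCB hg)).2.symm
    · have hsub : B.filter (fun g => ¬ Disjoint (P g) (P c)) ⊆
          ((Finset.range (k c + 1)).biUnion fun j => (F j)⁻¹ * F (k c)).image (· * c) := by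
        intro g hg
        obtain ⟨hgB, hg⟩ := Finset.mem_filter.1 hg
        obtain ⟨x, hx1, hx2⟩ := Finset.not_disjoint_iff.1 hg
        obtain ⟨a, ha, rfl⟩ := Finset.mem_image.1 hx1
        obtain ⟨b, hb, hab⟩ := Finset.mem_image.1 hx2
        refine Finset.mem_image.2 ⟨a⁻¹ * b, Finset.mem_biUnion.2 ⟨k g, ?_, ?_⟩, ?_⟩
        · exact Finset.mem_range.2 (Nat.lt_succ_of_le (hmax g hgB))
        · exact Finset.mul_mem_mul (Finset.inv_mem_inv ha) hb
        · rw [mul_assoc, hab, inv_mul_cancel_left]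
      have h1 : ((B.filter fun g => ¬ Disjoint (P g) (P c)).card : ℝ) ≤ M * (F (k c)).card :=
        (Nat.cast_le.2 ((Finset.card_le_card hsub).trans Finset.card_image_le)).trans (hT (k c))
      have h2 : ((B.filter fun g => Disjoint (P g) (P c)).card : ℝ) +
          (B.filter fun g => ¬ Disjoint (P g) (P c)).card = B.card := by
        exact_mod_cast Finset.card_filter_add_card_filter_not (s := B)
          (fun g => Disjoint (P g) (P c))
      rw [Finset.sum_insert hcC, mul_add]
      linarith

/-- A non-negative sup-additive set function dominates its sum over disjoint subsets. -/
lemma sum_le_of_supAdditive {G ι : Type*} [DecidableEq G] {e : Finset G → ℝ}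
    (h0 : ∀ E, E.Nonempty → 0 ≤ e E)
    (hadd : ∀ E F : Finset G, E.Nonempty → F.Nonempty → Disjoint E F → e E + e F ≤ e (E ∪ F))
    {P : ι → Finset G} (hP : ∀ i, (P i).Nonempty) {C : Finset ι}
    (hC : (C : Set ι).PairwiseDisjoint P) {W : Finset G} (hW : W.Nonempty)
    (hsub : ∀ i ∈ C, P i ⊆ W) : ∑ i ∈ C, e (P i) ≤ e W := by
  classical
  induction C using Finset.induction_on generalizing W with
  | empty => simpa using h0 W hW
  | insert i C hi ih =>
    rw [Finset.coe_insert] at hC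
    have hCd := hC.subset (Set.subset_insert i _)
    have hPi : P i ⊆ W := hsub i (Finset.mem_insert_self i C)
    have hPC : ∀ j ∈ C, P j ⊆ W \ P i := fun j hj => Finset.subset_sdiff.2
      ⟨hsub j (Finset.mem_insert_of_mem hj),
        hC (Set.mem_insert_of_mem _ hj) (Set.mem_insert _ _) (fun h => hi (h ▸ hj))⟩
    rw [Finset.sum_insert hi]
    rcases (W \ P i).eq_empty_or_nonempty with hE | hE
    · have hCe : C = ∅ := Finset.eq_empty_of_forall_notMem fun j hj => by
        have := hPC j hj
        rw [hE, Finset.subset_empty] at this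
        exact (hP j).ne_empty this
      have hWi : W = P i := (Finset.sdiff_eq_empty_iff_subset.1 hE).antisymm hPi
      simp [hCe, hWi]
    · have h1 := ih hCd hE hPC
      have h2 := hadd (P i) (W \ P i) (hP i) hE Finset.disjoint_sdiff
      rw [Finset.union_sdiff_of_subset hPi] at h2
      linarith

/-- Most points of a Følner set are moved inside it by a given finite set. -/
lemma IsFolner.tendsto_card_filter {G : Type*} [Group G] [DecidableEq G] {F : ℕ → Finset G}
    (hF : IsFolner F) (K : Finset G) :
    Tendsto (fun n => (((F n).filter fun g => ∀ f ∈ K, f * g ∈ F n).card : ℝ) / (F n).card)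
      atTop (𝓝 1) := by
  have hlim : Tendsto (fun n => 1 - ∑ f ∈ K,
      ((((F n).image (f * ·)) ∆ (F n)).card : ℝ) / ((F n).card : ℝ)) atTop (𝓝 1) := by
    simpa using (tendsto_finsetSum K fun f _ => hF.2 f).const_sub 1
  refine tendsto_of_tendsto_of_tendsto_of_le_of_le hlim tendsto_const_nhds (fun n => ?_)
    fun n => div_le_one_of_le₀ (Nat.cast_le.2 (Finset.card_filter_le _ _)) (by positivity)
  have hpos : (0 : ℝ) < (F n).card := by exact_mod_cast (hF.1 n).card_pos
  have hsub : F n ⊆ ((F n).filter fun g => ∀ f ∈ K, f * g ∈ F n) ∪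
      K.biUnion fun f => (F n).filter fun g => f * g ∉ F n := by
    intro g hg
    by_cases h : ∀ f ∈ K, f * g ∈ F n
    · exact Finset.mem_union_left _ (Finset.mem_filter.2 ⟨hg, h⟩)
    · push Not at h
      obtain ⟨f, hf, hfg⟩ := h
      exact Finset.mem_union_right _
        (Finset.mem_biUnion.2 ⟨f, hf, Finset.mem_filter.2 ⟨hg, hfg⟩⟩)
  have hf : ∀ f, ((F n).filter fun g => f * g ∉ F n).card ≤
      (((F n).image (f * ·)) ∆ (F n)).card := fun f => by
    refine Finset.card_le_card_of_injOn (f * ·) (fun g hg => ?_)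
      (mul_right_injective f).injOn
    obtain ⟨hg, hfg⟩ := Finset.mem_filter.1 hg
    exact Finset.mem_symmDiff.2 (Or.inl ⟨Finset.mem_image_of_mem _ hg, hfg⟩)
  have hcard : (F n).card ≤ ((F n).filter fun g => ∀ f ∈ K, f * g ∈ F n).card +
      ∑ f ∈ K, (((F n).image (f * ·)) ∆ (F n)).card :=
    (Finset.card_le_card hsub).trans <| (Finset.card_union_le _ _).trans <| by
      gcongr
      exact Finset.card_biUnion_le.trans (Finset.sum_le_sum fun f _ => hf f)
  have hcard' : ((F n).card : ℝ) ≤ ((F n).filter fun g => ∀ f ∈ K, f * g ∈ F n).card +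
      ∑ f ∈ K, ((((F n).image (f * ·)) ∆ (F n)).card : ℝ) := by exact_mod_cast hcard
  rw [← Finset.sum_div, sub_le_iff_le_add, ← add_div, le_div_iff₀ hpos, one_mul]
  exact hcard'

/-- Pointwise transference estimate along an orbit. -/
lemma card_filter_mul_le {G : Type*} [Group G] [DecidableEq G] {Y : Type*} [MulAction G Y]
    {d : Finset G → Y → ℝ} {F : ℕ → Finset G} {M α : ℝ} {y : Y} (hne : ∀ n, (F n).Nonempty)
    (hinv : ∀ n, ∀ g : G, d ((F n).image (· * g)) y = d (F n) (g • y))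
    (hnonneg : ∀ E : Finset G, E.Nonempty → 0 ≤ d E y)
    (hsup : ∀ E E' : Finset G, E.Nonempty → E'.Nonempty → Disjoint E E' →
      d E y + d E' y ≤ d (E ∪ E') y)
    (hM : 0 < M) (hTemp : TempelmanWith F M) (hα : 0 < α) (N : ℕ)
    {E W : Finset G} (hW : W.Nonempty)
    (hEW : ∀ g ∈ E, ∀ k ∈ Finset.range N, ∀ f ∈ F k, f * g ∈ W)
    (p : G → Prop) [DecidablePred p]
    (hp : ∀ g, p g ↔ ∃ k ∈ Finset.range N, α * (F k).card < d (F k) (g • y)) :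
    ((E.filter p).card : ℝ) ≤ M / α * d W y := by
  have hk : ∀ g, ∃ k, p g → k ∈ Finset.range N ∧ α * (F k).card < d (F k) (g • y) := fun g => by
    by_cases h : p g
    · obtain ⟨k, hk⟩ := (hp g).1 h
      exact ⟨k, fun _ => hk⟩
    · exact ⟨0, fun h' => absurd h' h⟩
  choose k hk using hk
  obtain ⟨C, hCB, hdisj, hcard⟩ := hTemp.exists_disjoint_translates hne k (E.filter p)
  have hsum : ∑ c ∈ C, d ((F (k c)).image (· * c)) y ≤ d W y := by
    refine sum_le_of_supAdditive (e := fun E => d E y) hnonneg hsup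
      (P := fun c => (F (k c)).image (· * c)) (fun c => (hne _).image _) hdisj hW fun c hc => ?_
    obtain ⟨hcE, hpc⟩ := Finset.mem_filter.1 (hCB hc)
    exact Finset.image_subset_iff.2 (hEW c hcE (k c) (hk c hpc).1)
  have hlow : α * ∑ c ∈ C, ((F (k c)).card : ℝ) ≤ ∑ c ∈ C, d ((F (k c)).image (· * c)) y := by
    rw [Finset.mul_sum]
    refine Finset.sum_le_sum fun c hc => ?_
    rw [hinv]
    exact (hk c (Finset.mem_filter.1 (hCB hc)).2).2.le
  rw [div_mul_eq_mul_div, le_div_iff₀ hα]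
  nlinarith [mul_le_mul_of_nonneg_left (hlow.trans hsum) hM.le]

section MaximalInequality

variable {G : Type*} [Group G] [DecidableEq G] {Y : Type*} [MeasurableSpace Y] [MulAction G Y]
  {ν : Measure Y} {d : Finset G → Y → ℝ} {F : ℕ → Finset G} {M α : ℝ}

/-- Maximal inequality for finitely many averages. -/
lemma measureReal_exists_lt_le [Countable G] [IsProbabilityMeasure ν]
    (hact : ∀ g : G, MeasurePreserving (fun y => g • y) ν ν)
    (hint : ∀ E : Finset G, E.Nonempty → Integrable (d E) ν)
    (hinv : ∀ E : Finset G, E.Nonempty → ∀ g : G,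
      ∀ᵐ y ∂ν, d (E.image (· * g)) y = d E (g • y))
    (hnonneg : ∀ E : Finset G, E.Nonempty → ∀ᵐ y ∂ν, 0 ≤ d E y)
    (hsup : ∀ E E' : Finset G, E.Nonempty → E'.Nonempty → Disjoint E E' →
      ∀ᵐ y ∂ν, d E y + d E' y ≤ d (E ∪ E') y)
    (hF : IsFolner F) (hM : 0 < M) (hTemp : TempelmanWith F M) (hα : 0 < α)
    {c : ℝ} (hc : ∀ n, ((F n).card : ℝ)⁻¹ * ∫ y, d (F n) y ∂ν ≤ c) (N : ℕ) :
    ν.real {y | ∃ k ∈ Finset.range N, α * (F k).card < d (F k) y} ≤ M / α * c := by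
  classical
  set A := {y | ∃ k ∈ Finset.range N, α * (F k).card < d (F k) y} with hA
  have hAm : NullMeasurableSet A ν := by
    have : A = ⋃ k ∈ Finset.range N, {y | α * (F k).card < d (F k) y} := by
      ext y; simp [hA]
    rw [this]
    exact Finset.nullMeasurableSet_biUnion _ fun k _ =>
      nullMeasurableSet_lt aemeasurable_const (hint _ (hF.1 k)).aemeasurable
  set K := (Finset.range N).biUnion F
  have key : ∀ n, (((F n).filter fun g => ∀ f ∈ K, f * g ∈ F n).card : ℝ) / (F n).card * ν.real A
      ≤ M / α * c := fun n => by
    set E := (F n).filter fun g => ∀ f ∈ K, f * g ∈ F n with hE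
    have hpos : (0 : ℝ) < (F n).card := by exact_mod_cast (hF.1 n).card_pos
    have hpre : ∀ g : G, NullMeasurableSet ((fun y => g • y) ⁻¹' A) ν := fun g =>
      hAm.preimage (hact g).quasiMeasurePreserving
    have hind : ∀ g : G, Integrable (((fun y => g • y) ⁻¹' A).indicator fun _ => (1 : ℝ)) ν :=
      fun g => (integrable_const 1).indicator₀ (hpre g)
    have hpt : ∀ᵐ y ∂ν, ∑ g ∈ E, ((fun y => g • y) ⁻¹' A).indicator (fun _ => (1 : ℝ)) y
        ≤ M / α * d (F n) y := by
      have h1 : ∀ᵐ y ∂ν, ∀ m, ∀ g : G, d ((F m).image (· * g)) y = d (F m) (g • y) :=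
        ae_all_iff.2 fun m => ae_all_iff.2 fun g => hinv _ (hF.1 m) g
      have h2 : ∀ᵐ y ∂ν, ∀ E : Finset G, E.Nonempty → 0 ≤ d E y :=
        ae_all_iff.2 fun E => ae_all_iff.2 fun h => hnonneg E h
      have h3 : ∀ᵐ y ∂ν, ∀ E E' : Finset G, E.Nonempty → E'.Nonempty → Disjoint E E' →
          d E y + d E' y ≤ d (E ∪ E') y :=
        ae_all_iff.2 fun E => ae_all_iff.2 fun E' => ae_all_iff.2 fun h => ae_all_iff.2 fun h' =>
          ae_all_iff.2 fun h'' => hsup E E' h h' h''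
      filter_upwards [h1, h2, h3] with y h1 h2 h3
      have := card_filter_mul_le hF.1 h1 h2 h3 hM hTemp hα N (hF.1 n) (E := E)
        (fun g hg k hk f hf => (Finset.mem_filter.1 hg).2 f (Finset.mem_biUnion.2 ⟨k, hk, hf⟩))
        (fun g => g • y ∈ A) fun g => Iff.rfl
      simpa [Set.indicator_apply, -Finset.sum_boole, ← Finset.sum_boole] using this
    have hI := integral_mono_ae (integrable_finsetSum E fun g _ => hind g)
      ((hint _ (hF.1 n)).const_mul (M / α)) hpt
    have hg : ∀ g : G, ∫ y, ((fun y => g • y) ⁻¹' A).indicator (fun _ => (1 : ℝ)) y ∂ν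
        = ν.real A := fun g => by
      rw [integral_indicator₀ (hpre g)]
      simp [measureReal_def, (hact g).measure_preimage hAm]
    rw [integral_finsetSum _ fun g _ => hind g, integral_const_mul] at hI
    simp only [hg, Finset.sum_const, nsmul_eq_mul] at hI
    calc (E.card : ℝ) / (F n).card * ν.real A
        = ((F n).card : ℝ)⁻¹ * (E.card * ν.real A) := by ring
      _ ≤ ((F n).card : ℝ)⁻¹ * (M / α * ∫ y, d (F n) y ∂ν) := by gcongr
      _ = M / α * (((F n).card : ℝ)⁻¹ * ∫ y, d (F n) y ∂ν) := by ring
      _ ≤ M / α * c := by gcongr; exact hc n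
  simpa using le_of_tendsto' ((hF.tendsto_card_filter K).mul_const (ν.real A)) key

/-- Maximal inequality with any upper bound of the normalised integrals over the sets `F n`. -/
lemma measure_lt_iSup_le [Countable G] [IsProbabilityMeasure ν]
    (hact : ∀ g : G, MeasurePreserving (fun y => g • y) ν ν)
    (hint : ∀ E : Finset G, E.Nonempty → Integrable (d E) ν)
    (hinv : ∀ E : Finset G, E.Nonempty → ∀ g : G,
      ∀ᵐ y ∂ν, d (E.image (· * g)) y = d E (g • y))
    (hnonneg : ∀ E : Finset G, E.Nonempty → ∀ᵐ y ∂ν, 0 ≤ d E y)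
    (hsup : ∀ E E' : Finset G, E.Nonempty → E'.Nonempty → Disjoint E E' →
      ∀ᵐ y ∂ν, d E y + d E' y ≤ d (E ∪ E') y)
    (hF : IsFolner F) (hM : 0 < M) (hTemp : TempelmanWith F M) (hα : 0 < α)
    {S : EReal} (hS : ∀ n, ((((F n).card : ℝ)⁻¹ * ∫ y, d (F n) y ∂ν : ℝ) : EReal) ≤ S) :
    (ν {y : Y | (α : EReal) < ⨆ k : ℕ, ((d (F k) y / ((F k).card : ℝ) : ℝ) : EReal)} : EReal)
      ≤ ((M / α : ℝ) : EReal) * S := by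
  induction S with
  | bot => exact absurd (le_bot_iff.1 (hS 0)) (EReal.coe_ne_bot _)
  | top => rw [EReal.coe_mul_top_of_pos (div_pos hM hα)]; exact le_top
  | coe c =>
    have hfin := measureReal_exists_lt_le hact hint hinv hnonneg hsup hF hM hTemp hα
      (c := c) fun n => EReal.coe_le_coe_iff.1 (hS n)
    have hU : {y : Y | (α : EReal) < ⨆ k : ℕ, ((d (F k) y / ((F k).card : ℝ) : ℝ) : EReal)} =
        ⋃ N : ℕ, {y | ∃ k ∈ Finset.range N, α * (F k).card < d (F k) y} := by
      ext y
      have hpos : ∀ k, (0 : ℝ) < (F k).card := fun k => by exact_mod_cast (hF.1 k).card_pos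
      simp only [Set.mem_ofPred_eq, lt_iSup_iff, EReal.coe_lt_coe_iff, Set.mem_iUnion,
        lt_div_iff₀ (hpos _), Finset.mem_range]
      exact ⟨fun ⟨k, hk⟩ => ⟨k + 1, k, k.lt_succ_self, hk⟩, fun ⟨_, k, _, hk⟩ => ⟨k, hk⟩⟩
    have hmono : Monotone fun N : ℕ =>
        {y | ∃ k ∈ Finset.range N, α * (F k).card < d (F k) y} :=
      fun N N' h y ⟨k, hk, hy⟩ => ⟨k, Finset.range_mono h hk, hy⟩
    have hle : ν (⋃ N : ℕ, {y | ∃ k ∈ Finset.range N, α * (F k).card < d (F k) y}) ≤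
        ENNReal.ofReal (M / α * c) := by
      rw [hmono.measure_iUnion]
      exact iSup_le fun N => ENNReal.le_ofReal_iff_toReal_le (measure_ne_top _ _)
        (measureReal_nonneg.trans (hfin N)) |>.2 (hfin N)
    rw [hU, ← EReal.coe_mul]
    calc _ ≤ ((ENNReal.ofReal (M / α * c) : ℝ≥0∞) : EReal) :=
          EReal.coe_ennreal_le_coe_ennreal_iff.2 hle
      _ = _ := by rw [EReal.coe_ennreal_ofReal, max_eq_left (measureReal_nonneg.trans (hfin 0))]

end MaximalInequality

/-- Corollary 2.9 of the paper: for a non-negative sup-additive `G`-invariant family `𝐃` and a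
Følner sequence satisfying the Tempelman condition with constant `M > 0`, if either each `F_n`
tiles `G` or the family is strongly sup-additive, then
`ν({y : sup_k d_{F_k}(y)/|F_k| > α}) ≤ (M/α) ν(𝐃)` for every `α > 0`;
here `ν(𝐃) = sup_{T ∈ 𝒯_G} (1/|T|)∫ d_T dν` in the first case and
`ν(𝐃) = sup_{F ∈ 𝓕_G} (1/|F|)∫ d_F dν` in the strongly sup-additive case. -/
theorem maximal_inequality_sup
    {G : Type*} [Group G] [Countable G] [Infinite G] [DecidableEq G]
    {Y : Type*} [MeasurableSpace Y] [MulAction G Y]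
    (ν : Measure Y) [IsProbabilityMeasure ν]
    (hact : ∀ g : G, MeasurePreserving (fun y => g • y) ν ν)
    (d : Finset G → Y → ℝ)
    (hint : ∀ F : Finset G, F.Nonempty → Integrable (d F) ν)
    (hinv : ∀ F : Finset G, F.Nonempty → ∀ g : G,
      ∀ᵐ y ∂ν, d (F.image (· * g)) y = d F (g • y))
    (hnonneg : ∀ F : Finset G, F.Nonempty → ∀ᵐ y ∂ν, 0 ≤ d F y)
    (hsup : ∀ E F : Finset G, E.Nonempty → F.Nonempty → Disjoint E F →
      ∀ᵐ y ∂ν, d E y + d F y ≤ d (E ∪ F) y)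
    (F : ℕ → Finset G) (hF : IsFolner F)
    (M : ℝ) (hM : 0 < M) (hTemp : TempelmanWith F M)
    (α : ℝ) (hα : 0 < α) :
    ((∀ n, Tiles (F n)) →
      (ν {y : Y | (α : EReal) < ⨆ k : ℕ, ((d (F k) y / ((F k).card : ℝ) : ℝ) : EReal)} : EReal)
        ≤ ((M / α : ℝ) : EReal)
          * ⨆ T ∈ {T : Finset G | Tiles T},
              (((T.card : ℝ)⁻¹ * ∫ y, d T y ∂ν : ℝ) : EReal)) ∧
    (((∀ y, d ∅ y = 0) ∧ ∀ E F' : Finset G,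
          ∀ᵐ y ∂ν, d E y + d F' y ≤ d (E ∩ F') y + d (E ∪ F') y) →
      (ν {y : Y | (α : EReal) < ⨆ k : ℕ, ((d (F k) y / ((F k).card : ℝ) : ℝ) : EReal)} : EReal)
        ≤ ((M / α : ℝ) : EReal)
          * ⨆ E ∈ {E : Finset G | E.Nonempty},
              (((E.card : ℝ)⁻¹ * ∫ y, d E y ∂ν : ℝ) : EReal)) := by
  exact ⟨fun hT => measure_lt_iSup_le hact hint hinv hnonneg hsup hF hM hTemp hα fun n =>
      le_iSup₂ (f := fun (T : Finset G) (_ : T ∈ {T : Finset G | Tiles T}) =>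
        (((T.card : ℝ)⁻¹ * ∫ y, d T y ∂ν : ℝ) : EReal)) (F n) (hT n),
    fun _ => measure_lt_iSup_le hact hint hinv hnonneg hsup hF hM hTemp hα fun n =>
      le_iSup₂ (f := fun (E : Finset G) (_ : E ∈ {E : Finset G | E.Nonempty}) =>
        (((E.card : ℝ)⁻¹ * ∫ y, d E y ∂ν : ℝ) : EReal)) (F n) (hF.1 n)⟩
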